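/- Let k ≥ 2 and 1 ≤ r ≤ k−1, and let μ be a pattern of length k. Then the number of permutations σ of {1,…,2k−r} that consecutively contain μ at position 1 and also consecutively contain μ at position k−r+1 is at most 2^{2k−2r}. -/

import Mathlib

/-- `σ` consecutively contains the pattern `μ` of length `k` at (0-indexed) position `i`. -/
def ContainsAt {m k : ℕ} (σ : Equiv.Perm (Fin m)) (μ : Equiv.Perm (Fin k))
    (i : ℕ) (h : i + k ≤ m) : Prop :=
  ∀ a b : Fin k,
    σ ⟨i + a.val, by have := a.isLt; omega⟩ < σ ⟨i + b.val, by have := b.isLt; omega⟩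
      ↔ μ a < μ b

open Finset

theorem Finset.eq_of_card_filter_lt_eq {α : Type*} [LinearOrder α] {A : Finset α} {x y : α}
    (hx : x ∈ A) (hy : y ∈ A) (h : #{v ∈ A | v < x} = #{v ∈ A | v < y}) : x = y := by
  have key : ∀ {a b : α}, a ∈ A → a < b → #{v ∈ A | v < a} < #{v ∈ A | v < b} := by
    intro a b ha hab
    refine card_lt_card ((ssubset_iff_of_subset ?_).2 ⟨a, by simp [ha, hab], by simp⟩)
    exact monotone_filter_right A fun v _ hv => hv.trans hab
  rcases lt_trichotomy x y with hxy | hxy | hxy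
  · exact absurd h (key hx hxy).ne
  · exact hxy
  · exact absurd h.symm (key hy hxy).ne

/-- Two injections with the same image on `s` that agree about which elements of `s` lie below
`p ∈ s` take the same value at `p`. -/
theorem Finset.eq_of_image_eq_of_lt_iff {ι α : Type*} [LinearOrder α] {f g : ι → α}
    (hf : Function.Injective f) (hg : Function.Injective g) {s : Finset ι}
    (h : s.image f = s.image g) {p : ι} (hp : p ∈ s)
    (hlt : ∀ q ∈ s, f q < f p ↔ g q < g p) : f p = g p := by
  refine eq_of_card_filter_lt_eq (A := s.image f) (mem_image_of_mem f hp)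
    (h ▸ mem_image_of_mem g hp) ?_
  conv_rhs => rw [h]
  rw [filter_image, filter_image, card_image_of_injective _ hf, card_image_of_injective _ hg,
    filter_congr hlt]

theorem ContainsAt.lt_iff_lt {m k i : ℕ} {σ τ : Equiv.Perm (Fin m)} {μ : Equiv.Perm (Fin k)}
    {h : i + k ≤ m} (hσ : ContainsAt σ μ i h) (hτ : ContainsAt τ μ i h) {p q : Fin m}
    (hp : i ≤ p) (hp' : p < i + k) (hq : i ≤ q) (hq' : q < i + k) :
    σ p < σ q ↔ τ p < τ q := by
  have hσ' := hσ ⟨p - i, by omega⟩ ⟨q - i, by omega⟩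
  have hτ' := hτ ⟨p - i, by omega⟩ ⟨q - i, by omega⟩
  simp only [Nat.add_sub_cancel' hp, Nat.add_sub_cancel' hq, Fin.eta] at hσ' hτ'
  exact hσ'.trans hτ'.symm

theorem overlap_count_bound (k r : ℕ) (hk : 2 ≤ k) (hr1 : 1 ≤ r) (hrk : r ≤ k - 1)
    (μ : Equiv.Perm (Fin k)) :
    Nat.card {σ : Equiv.Perm (Fin (2 * k - r)) //
        ∃ (h1 : 0 + k ≤ 2 * k - r) (h2 : (k - r) + k ≤ 2 * k - r),
          ContainsAt σ μ 0 h1 ∧ ContainsAt σ μ (k - r) h2} ≤ 2 ^ (2 * k - 2 * r) := by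
  set P : Equiv.Perm (Fin (2 * k - r)) → Prop := fun σ =>
    ∃ (h1 : 0 + k ≤ 2 * k - r) (h2 : (k - r) + k ≤ 2 * k - r),
      ContainsAt σ μ 0 h1 ∧ ContainsAt σ μ (k - r) h2
  rcases isEmpty_or_nonempty {σ // P σ} with hE | ⟨σ₀, hσ₀⟩
  · simp
  have hlt : ∀ {σ τ}, P σ → P τ → ∀ {p q : Fin (2 * k - r)},
      (p.val < k ∧ q.val < k) ∨ (k - r ≤ p.val ∧ k - r ≤ q.val) →
      (σ p < σ q ↔ τ p < τ q) := by
    rintro σ τ ⟨h1, h2, hσ1, hσ2⟩ ⟨_, _, hτ1, hτ2⟩ p q (⟨hp, hq⟩ | ⟨hp, hq⟩)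
    · exact hσ1.lt_iff_lt hτ1 (by omega) (by omega) (by omega) (by omega)
    · exact hσ2.lt_iff_lt hτ2 hp (by omega) hq (by omega)
  have hmid : ∀ {σ τ}, P σ → P τ → ∀ p : Fin (2 * k - r), k - r ≤ p.val → p.val < k →
      σ p = τ p := fun {σ τ} hσ hτ p hp hp' =>
    eq_of_image_eq_of_lt_iff σ.injective τ.injective (by simp) (mem_univ p)
      fun q _ => hlt hσ hτ (by omega)
  set F : Finset (Fin (2 * k - r)) := {p | p.val < k - r} with hF
  set M : Finset (Fin (2 * k - r)) := {p | k - r ≤ p.val ∧ p.val < k} with hM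
  have hMcard : #M = r := by
    have : M.map Fin.valEmbedding = Ico (k - r) k := by
      ext a
      simp only [hM, mem_map, mem_filter, mem_univ, true_and, Fin.valEmbedding_apply, mem_Ico]
      constructor
      · rintro ⟨p, hp, rfl⟩
        exact hp
      · intro ha
        exact ⟨⟨a, by omega⟩, ha, rfl⟩
    rw [← card_map Fin.valEmbedding, this, Nat.card_Ico]
    omega
  have himage : ∀ {σ}, P σ → F.image σ ∈ ((M.image σ₀)ᶜ).powerset := by
    intro σ hσ
    rw [mem_powerset]
    intro v hv
    obtain ⟨p, hp, rfl⟩ := mem_image.1 hv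
    rw [mem_compl, mem_image]
    rintro ⟨q, hq, hqp⟩
    simp only [hF, hM, mem_filter, mem_univ, true_and] at hp hq
    rw [← hmid hσ hσ₀ q hq.1 hq.2] at hqp
    have := σ.injective hqp
    omega
  have hcard : Nat.card ((M.image σ₀)ᶜ).powerset = 2 ^ (2 * k - 2 * r) := by
    rw [Nat.card_eq_fintype_card, Fintype.card_coe, card_powerset, card_compl,
      card_image_of_injective _ σ₀.injective, hMcard, Fintype.card_fin]
    congr 1
    omega
  rw [← hcard]
  refine Nat.card_le_card_of_injective
    (fun σ : {σ // P σ} => (⟨F.image σ.1, himage σ.2⟩ : ((M.image σ₀)ᶜ).powerset)) ?_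
  rintro ⟨σ, hσ⟩ ⟨τ, hτ⟩ h
  have hFim : F.image σ = F.image τ := congrArg Subtype.val h
  have hleft : ∀ p : Fin (2 * k - r), p.val < k → σ p = τ p := by
    intro p hp
    rcases lt_or_ge p.val (k - r) with hpF | hpM
    · refine eq_of_image_eq_of_lt_iff σ.injective τ.injective hFim (by simpa [hF]) ?_
      intro q hq
      simp only [hF, mem_filter, mem_univ, true_and] at hq
      exact hlt hσ hτ (by omega)
    · exact hmid hσ hτ p hpM hp
  set K : Finset (Fin (2 * k - r)) := {p | p.val < k} with hK
  have hKim : Kᶜ.image σ = Kᶜ.image τ := by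
    rw [compl_eq_univ_sdiff, image_sdiff _ _ σ.injective, image_sdiff _ _ τ.injective,
      image_univ_equiv, image_univ_equiv]
    congr 1
    exact image_congr fun p hp => hleft p (by simpa [hK] using hp)
  refine Subtype.ext (Equiv.ext fun p => ?_)
  rcases lt_or_ge p.val k with hp | hp
  · exact hleft p hp
  · refine eq_of_image_eq_of_lt_iff σ.injective τ.injective hKim (by simpa [hK]) ?_
    intro q hq
    simp only [hK, mem_compl, mem_filter, mem_univ, true_and] at hq
    exact hlt hσ hτ (by omega)
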